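/- The forgetful functor from the category of Poisson Hopf algebras over a field k to the category of Poisson bialgebras over k has a left adjoint; in particular, the category of Poisson Hopf algebras is a reflective subcategory of the category of Poisson bialgebras. -/

import Mathlib

open TensorProduct

universe u v w x

/-- A Poisson (bracket) structure on a commutative `k`-algebra `A`: a bilinear,
alternating bracket satisfying the Jacobi and Leibniz identities. -/
structure PoissonStr (k : Type u) (A : Type v) [CommRing k] [CommRing A] [Algebra k A] where
  br : A →ₗ[k] A →ₗ[k] A
  br_self : ∀ a : A, br a a = 0
  jacobi : ∀ a b c : A, br a (br b c) = br (br a b) c + br b (br a c)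
  leibniz : ∀ a b c : A, br a (b * c) = br a b * c + b * br a c

/-- `f` is a morphism of Poisson algebras. -/
def IsPoissonHom {k : Type u} {A : Type v} {B : Type w} [CommRing k]
    [CommRing A] [Algebra k A] [CommRing B] [Algebra k B]
    (PA : PoissonStr k A) (PB : PoissonStr k B) (f : A →ₐ[k] B) : Prop :=
  ∀ a b : A, f (PA.br a b) = PB.br (f a) (f b)

/-- `T` is the tensor-product Poisson structure on `A ⊗[k] B`. -/
def IsTensorPoissonStr {k : Type u} {A : Type v} {B : Type w} [CommRing k]
    [CommRing A] [Algebra k A] [CommRing B] [Algebra k B]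
    (PA : PoissonStr k A) (PB : PoissonStr k B) (T : PoissonStr k (A ⊗[k] B)) : Prop :=
  ∀ (p r : A) (q s : B),
    T.br (p ⊗ₜ[k] q) (r ⊗ₜ[k] s) = (p * r) ⊗ₜ[k] PB.br q s + PA.br p r ⊗ₜ[k] (q * s)

/-- A coalgebra structure (as data) on a `k`-module `C`. -/
structure CoalgData (k : Type u) (C : Type v) [CommRing k] [AddCommGroup C] [Module k C] where
  comul : C →ₗ[k] C ⊗[k] C
  counit : C →ₗ[k] k
  coassoc : ∀ c : C, TensorProduct.map comul LinearMap.id (comul c) =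
    (TensorProduct.assoc k C C C).symm (TensorProduct.map LinearMap.id comul (comul c))
  counit_comul : ∀ c : C,
    TensorProduct.lid k C (TensorProduct.map counit LinearMap.id (comul c)) = c
  comul_counit : ∀ c : C,
    TensorProduct.rid k C (TensorProduct.map LinearMap.id counit (comul c)) = c

/-- `f` is a morphism of coalgebras. -/
def IsCoalgHom {k : Type u} {C : Type v} {D : Type w} [CommRing k]
    [AddCommGroup C] [Module k C] [AddCommGroup D] [Module k D]
    (DC : CoalgData k C) (DD : CoalgData k D) (f : C →ₗ[k] D) : Prop :=
  (∀ c : C, DD.comul (f c) = TensorProduct.map f f (DC.comul c)) ∧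
  (∀ c : C, DD.counit (f c) = DC.counit c)

/-- A (commutative) bialgebra structure (as data) on a commutative `k`-algebra `B`:
the comultiplication and the counit are algebra maps, the coalgebra axioms hold. -/
structure BialgData (k : Type u) (B : Type v) [CommRing k] [CommRing B] [Algebra k B] where
  comul : B →ₐ[k] B ⊗[k] B
  counit : B →ₐ[k] k
  coassoc : ∀ b : B,
    TensorProduct.map comul.toLinearMap LinearMap.id (comul b) =
      (TensorProduct.assoc k B B B).symm (TensorProduct.map LinearMap.id comul.toLinearMap (comul b))
  counit_comul : ∀ b : B,
    TensorProduct.lid k B (TensorProduct.map counit.toLinearMap LinearMap.id (comul b)) = b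
  comul_counit : ∀ b : B,
    TensorProduct.rid k B (TensorProduct.map LinearMap.id counit.toLinearMap (comul b)) = b

/-- The underlying coalgebra of a bialgebra. -/
def BialgData.toCoalgData {k : Type u} {B : Type v} [CommRing k] [CommRing B] [Algebra k B]
    (D : BialgData k B) : CoalgData k B where
  comul := D.comul.toLinearMap
  counit := D.counit.toLinearMap
  coassoc := D.coassoc
  counit_comul := D.counit_comul
  comul_counit := D.comul_counit

/-- A Hopf algebra structure (as data): a bialgebra together with an antipode. -/
structure HopfData (k : Type u) (B : Type v) [CommRing k] [CommRing B] [Algebra k B]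
    extends BialgData k B where
  antipode : B →ₗ[k] B
  antipode_comul : ∀ b : B,
    LinearMap.mul' k B (TensorProduct.map antipode LinearMap.id (comul b)) =
      algebraMap k B (counit b)
  comul_antipode : ∀ b : B,
    LinearMap.mul' k B (TensorProduct.map LinearMap.id antipode (comul b)) =
      algebraMap k B (counit b)

/-- The bialgebra `D` together with the Poisson structure `PS` is a Poisson bialgebra:
the comultiplication is a morphism of Poisson algebras into `B ⊗ B` with the tensor
Poisson structure. -/
def IsPoissonBialg {k : Type u} {B : Type v} [CommRing k] [CommRing B] [Algebra k B]
    (PS : PoissonStr k B) (D : BialgData k B) : Prop :=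
  ∃ T : PoissonStr k (B ⊗[k] B), IsTensorPoissonStr PS PS T ∧
    ∀ a b : B, D.comul (PS.br a b) = T.br (D.comul a) (D.comul b)

/-- `f` is a morphism of Poisson bialgebras. -/
def IsPoissonBialgHom {k : Type u} {A : Type v} {B : Type w} [CommRing k]
    [CommRing A] [Algebra k A] [CommRing B] [Algebra k B]
    (PA : PoissonStr k A) (PB : PoissonStr k B)
    (DA : BialgData k A) (DB : BialgData k B) (f : A →ₐ[k] B) : Prop :=
  IsPoissonHom PA PB f ∧
  (∀ a : A, DB.comul (f a) = TensorProduct.map f.toLinearMap f.toLinearMap (DA.comul a)) ∧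
  (∀ a : A, DB.counit (f a) = DA.counit a)

/-- `f` is a morphism of Poisson bialgebras into the opposite-coopposite. -/
def IsOpPoissonBialgHom {k : Type u} {A : Type v} {B : Type w} [CommRing k]
    [CommRing A] [Algebra k A] [CommRing B] [Algebra k B]
    (PA : PoissonStr k A) (PB : PoissonStr k B)
    (DA : BialgData k A) (DB : BialgData k B) (f : A →ₐ[k] B) : Prop :=
  (∀ a b : A, f (PA.br a b) = PB.br (f b) (f a)) ∧
  (∀ a : A, DB.comul (f a) =
    TensorProduct.comm k B B (TensorProduct.map f.toLinearMap f.toLinearMap (DA.comul a))) ∧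
  (∀ a : A, DB.counit (f a) = DA.counit a)

/-- A Poisson ideal: an associative ideal which is also a Lie ideal. -/
def IsPoissonIdeal {k : Type u} {Q : Type v} [CommRing k] [CommRing Q] [Algebra k Q]
    (PS : PoissonStr k Q) (I : Ideal Q) : Prop :=
  ∀ p : Q, ∀ a ∈ I, PS.br p a ∈ I

/-- The Poisson ideal generated by a set. -/
def poissonIdealGen {k : Type u} {Q : Type v} [CommRing k] [CommRing Q] [Algebra k Q]
    (PS : PoissonStr k Q) (S : Set Q) : Ideal Q :=
  sInf {I : Ideal Q | S ⊆ I ∧ IsPoissonIdeal PS I}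

/-- The subspace `Q ⊗ I + I ⊗ Q` of `Q ⊗ Q`. -/
def sweedlerSpan {k : Type u} {Q : Type v} [CommRing k] [CommRing Q] [Algebra k Q]
    (I : Submodule k Q) : Submodule k (Q ⊗[k] Q) :=
  LinearMap.range (TensorProduct.map LinearMap.id I.subtype) ⊔
    LinearMap.range (TensorProduct.map I.subtype LinearMap.id)

/-- A bundled Poisson algebra. -/
structure PoissonAlgBundle (k : Type u) [CommRing k] where
  carrier : Type v
  [ring : CommRing carrier]
  [alg : Algebra k carrier]
  str : PoissonStr k carrier

attribute [instance] PoissonAlgBundle.ring PoissonAlgBundle.alg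

/-- A bundled Poisson bialgebra. -/
structure PoissonBialgBundle (k : Type u) [CommRing k] extends PoissonAlgBundle.{u, v} k where
  bi : BialgData k carrier
  compat : IsPoissonBialg str bi

/-- A bundled Poisson Hopf algebra. -/
structure PoissonHopfBundle (k : Type u) [CommRing k] extends PoissonAlgBundle.{u, v} k where
  hopf : HopfData k carrier
  compat : IsPoissonBialg str hopf.toBialgData

section PoissonPart

set_option linter.unusedSectionVars false

variable {k : Type u} [CommRing k]

lemma PoissonStr.skew {A : Type v} [CommRing A] [Algebra k A] (P : PoissonStr k A) (a b : A) :
    P.br a b = - P.br b a := by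
  have h := P.br_self (a + b)
  simp only [map_add, LinearMap.add_apply, P.br_self] at h
  linear_combination h

lemma PoissonStr.leibniz_left {A : Type v} [CommRing A] [Algebra k A] (P : PoissonStr k A)
    (a b c : A) : P.br (a * b) c = P.br a c * b + a * P.br b c := by
  rw [P.skew, P.leibniz, P.skew c a, P.skew c b]; ring

/-- The bracket on a tensor product. -/
noncomputable def tensorBr {A : Type v} {B : Type w} [CommRing A] [Algebra k A] [CommRing B]
    [Algebra k B] (PA : PoissonStr k A) (PB : PoissonStr k B) :
    (A ⊗[k] B) →ₗ[k] (A ⊗[k] B) →ₗ[k] (A ⊗[k] B) :=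
  TensorProduct.map₂ (LinearMap.mul k A) PB.br + TensorProduct.map₂ PA.br (LinearMap.mul k B)

lemma tensorBr_tmul {A : Type v} {B : Type w} [CommRing A] [Algebra k A] [CommRing B]
    [Algebra k B] (PA : PoissonStr k A) (PB : PoissonStr k B) (p r : A) (q s : B) :
    tensorBr PA PB (p ⊗ₜ[k] q) (r ⊗ₜ[k] s)
      = (p * r) ⊗ₜ[k] PB.br q s + PA.br p r ⊗ₜ[k] (q * s) := by
  simp [tensorBr]

lemma tmul_split {A : Type v} {B : Type w} [CommRing A] [Algebra k A] [CommRing B]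
    [Algebra k B] (a : A) (b : B) :
    a ⊗ₜ[k] b = (Algebra.TensorProduct.includeLeft (R := k) (S := k) (A := A) (B := B) a) *
      (Algebra.TensorProduct.includeRight (R := k) (A := A) (B := B) b) := by simp

lemma tensorBr_skew {A : Type v} {B : Type w} [CommRing A] [Algebra k A] [CommRing B]
    [Algebra k B] (PA : PoissonStr k A) (PB : PoissonStr k B) (x y : A ⊗[k] B) :
    tensorBr PA PB x y = - tensorBr PA PB y x := by
  induction x with
  | zero => simp
  | add x x' hx hx' => rw [map_add, LinearMap.add_apply, hx, hx', map_add, neg_add]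
  | tmul p q =>
    induction y with
    | zero => simp
    | add y y' hy hy' => rw [map_add, map_add, LinearMap.add_apply, hy, hy', neg_add]
    | tmul r s =>
      rw [tensorBr_tmul, tensorBr_tmul, PB.skew q s, PA.skew p r, mul_comm p, mul_comm q,
        TensorProduct.tmul_neg, TensorProduct.neg_tmul, neg_add]

lemma tensorBr_leibniz {A : Type v} {B : Type w} [CommRing A] [Algebra k A] [CommRing B]
    [Algebra k B] (PA : PoissonStr k A) (PB : PoissonStr k B) (x y z : A ⊗[k] B) :
    tensorBr PA PB x (y * z) = tensorBr PA PB x y * z + y * tensorBr PA PB x z := by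
  induction x with
  | zero => simp
  | add x x' hx hx' => simp only [map_add, LinearMap.add_apply, hx, hx']; ring
  | tmul p q =>
    induction y with
    | zero => simp
    | add y y' hy hy' => simp only [map_add, add_mul, hy, hy']; ring
    | tmul r s =>
      induction z with
      | zero => simp
      | add z z' hz hz' => simp only [map_add, mul_add, hz, hz']; ring
      | tmul t w =>
        simp only [Algebra.TensorProduct.tmul_mul_tmul, tensorBr_tmul, PA.leibniz, PB.leibniz,
          TensorProduct.tmul_add, TensorProduct.add_tmul, add_mul, mul_add]
        have e1 : p * (r * t) = p * r * t := by ring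
        have e2 : r * (p * t) = p * r * t := by ring
        have e3 : q * (s * w) = q * s * w := by ring
        have e4 : s * (q * w) = q * s * w := by ring
        rw [e1, e2, e3, e4]
        abel

/-- The tensor product Poisson structure. -/
noncomputable def tensorPoisson {A : Type v} {B : Type w} [CommRing A] [Algebra k A] [CommRing B]
    [Algebra k B] (PA : PoissonStr k A) (PB : PoissonStr k B) : PoissonStr k (A ⊗[k] B) where
  br := tensorBr PA PB
  br_self x := by
    induction x with
    | zero => simp
    | tmul p q => simp [tensorBr_tmul, PA.br_self, PB.br_self]
    | add x y hx hy =>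
      simp only [map_add, LinearMap.add_apply, hx, hy]
      rw [tensorBr_skew PA PB x y]; simp
  jacobi x y z := by
    induction x with
    | zero => simp
    | add x x' hx hx' => simp only [map_add, LinearMap.add_apply, hx, hx']; abel
    | tmul p q =>
      induction y with
      | zero => simp
      | add y y' hy hy' => simp only [map_add, LinearMap.add_apply, hy, hy']; abel
      | tmul r s =>
        induction z with
        | zero => simp
        | add z z' hz hz' => simp only [map_add, hz, hz']; abel
        | tmul t w =>
          simp only [tensorBr_tmul, map_add, LinearMap.add_apply, PA.leibniz, PB.leibniz,
            PA.leibniz_left, PB.leibniz_left]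
          rw [PA.jacobi p r t, PB.jacobi q s w]
          rw [PA.skew r p, PB.skew s q]
          simp only [tmul_split, map_add, map_mul, map_neg]
          ring
  leibniz := tensorBr_leibniz PA PB

lemma tensorPoisson_isTensor {A : Type v} {B : Type w} [CommRing A] [Algebra k A] [CommRing B]
    [Algebra k B] (PA : PoissonStr k A) (PB : PoissonStr k B) :
    IsTensorPoissonStr PA PB (tensorPoisson PA PB) :=
  fun p r q s => tensorBr_tmul PA PB p r q s

lemma tensorPoisson_map {A B : Type v} [CommRing A] [Algebra k A] [CommRing B]
    [Algebra k B] (PA : PoissonStr k A) (PB : PoissonStr k B) (f : A →ₐ[k] B)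
    (hf : IsPoissonHom PA PB f) (TA : PoissonStr k (A ⊗[k] A)) (TB : PoissonStr k (B ⊗[k] B))
    (hA : IsTensorPoissonStr PA PA TA) (hB : IsTensorPoissonStr PB PB TB) :
    IsPoissonHom TA TB (Algebra.TensorProduct.map f f) := by
  intro x y
  induction x with
  | zero => simp
  | add x x' hx hx' => simp only [map_add, LinearMap.add_apply, hx, hx']
  | tmul p q =>
    induction y with
    | zero => simp
    | add y y' hy hy' => simp only [map_add, hy, hy']
    | tmul r s =>
      rw [hA, map_add]
      simp only [Algebra.TensorProduct.map_tmul]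
      rw [hB]
      simp only [map_mul, hf _ _]

variable {B H : Type v} [CommRing B] [Algebra k B] [CommRing H] [Algebra k H] [Algebra B H]
  [IsScalarTower k B H]

/-- Extension of a derivation to a localization. -/
lemma exists_derivation_ext (G : Submonoid B) [IsLocalization G H]
    {M : Type w} [AddCommGroup M] [Module k M] [Module B M] [Module H M]
    [IsScalarTower B H M] [IsScalarTower k H M] [IsScalarTower k B M] (D : Derivation k B M) :
    ∃ E : Derivation k H M, ∀ b, E (algebraMap B H b) = D b := by
  have := Algebra.FormallyEtale.of_isLocalization (Rₘ := H) G
  refine ⟨((D.liftKaehlerDifferential.liftBaseChange H) ∘ₗ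
    (KaehlerDifferential.tensorKaehlerEquivOfFormallyEtale k B H).symm.toLinearMap).compDer
      (KaehlerDifferential.D k H), fun b => ?_⟩
  have := KaehlerDifferential.tensorKaehlerEquivOfFormallyEtale_symm_D_algebraMap k B H b
  simp [this]

lemma derivation_ext_loc (G : Submonoid B) [IsLocalization G H]
    {M : Type w} [AddCommGroup M] [Module k M] [Module H M]
    (D E : Derivation k H M) (h : ∀ b, D (algebraMap B H b) = E (algebraMap B H b)) : D = E := by
  ext x
  obtain ⟨⟨b, g⟩, hx⟩ := IsLocalization.surj G x
  have hu : IsUnit (algebraMap B H g) := IsLocalization.map_units H g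
  have h1 := congrArg D hx
  have h2 := congrArg E hx
  simp only [Derivation.leibniz, h] at h1 h2
  have h3 := h1.trans h2.symm
  simp only [add_right_inj] at h3
  exact (hu.smul_left_cancel).1 h3

variable (H) in
/-- The extension of a Poisson bracket to a localization. -/
theorem exists_poisson_loc (G : Submonoid B) [IsLocalization G H]
    (P : PoissonStr k B) :
    ∃ Q : PoissonStr k H, ∀ a b, Q.br (algebraMap B H a) (algebraMap B H b)
      = algebraMap B H (P.br a b) := by
  let D0 (a : B) : Derivation k B H := Derivation.mk'
    ((Algebra.linearMap B H).restrictScalars k ∘ₗ P.br a) (by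
      intro x y
      simp [P.leibniz, Algebra.smul_def]; ring)
  have hD0 : ∀ a b, D0 a b = algebraMap B H (P.br a b) := fun a b => rfl
  choose E0 hE0 using fun a => exists_derivation_ext (H := H) G (D0 a)
  let D1 : Derivation k B (Derivation k H H) := Derivation.mk'
    { toFun := E0
      map_add' := fun a b => derivation_ext_loc G _ _ (fun c => by
        simp [hE0, hD0])
      map_smul' := fun a b => derivation_ext_loc G _ _ (fun c => by
        simp only [Derivation.smul_apply, hE0, hD0, map_smul, LinearMap.smul_apply,
          RingHom.id_apply]
        rw [Algebra.smul_def, Algebra.smul_def, map_mul, ← IsScalarTower.algebraMap_apply]) }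
    (fun a b => derivation_ext_loc G _ _ (fun c => by
        simp [hE0, hD0, P.leibniz_left, Algebra.smul_def]; ring))
  have hD1 : ∀ a b, D1 a (algebraMap B H b) = algebraMap B H (P.br a b) := fun a b => by
    rw [← hD0, ← hE0]; rfl
  obtain ⟨E, hE⟩ := exists_derivation_ext (H := H) G D1
  have hEE : ∀ a b, E (algebraMap B H a) (algebraMap B H b) = algebraMap B H (P.br a b) := by
    intro a b; rw [hE, hD1]
  have hl : ∀ x y z, E (x * y) z = E x z * y + x * E y z := by
    intro x y z; rw [E.leibniz]; simp; ring
  have hr : ∀ x y z, E x (y * z) = E x y * z + y * E x z := by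
    intro x y z; rw [Derivation.leibniz]; simp; ring
  have key : ∀ p : H → Prop, (∀ b, p (algebraMap B H b)) →
      (∀ x g, p g → IsUnit g → p (x * g) → p x) → ∀ x, p x := by
    intro p h1 h2 x
    obtain ⟨⟨b, g⟩, hx⟩ := IsLocalization.surj G x
    exact h2 x _ (h1 g) (IsLocalization.map_units H g) (hx ▸ h1 b)
  have hskew0 : ∀ (a : B) (y : H), E (algebraMap B H a) y = - E y (algebraMap B H a) := by
    intro a
    refine key _ (fun b => ?_) (fun x g hg hu hxg => ?_)
    · rw [hEE, hEE, P.skew, map_neg]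
    · rw [hr, hl, hg] at hxg
      apply hu.mul_left_cancel
      linear_combination hxg
  have hskew : ∀ x y : H, E x y = - E y x := by
    intro x
    refine key _ (fun b => ?_) (fun y g hg hu hyg => ?_)
    · rw [hskew0, neg_neg]
    · rw [hr, hl, hg] at hyg
      apply hu.mul_left_cancel
      linear_combination hyg
  have hself : ∀ x : H, E x x = 0 := by
    intro x
    obtain ⟨⟨b, g⟩, hx⟩ := IsLocalization.surj G x
    have hu : IsUnit (algebraMap B H g) := IsLocalization.map_units H g
    set γ := algebraMap B H g
    have hb : E (x * γ) (x * γ) = 0 := by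
      rw [hx, hEE, P.br_self, map_zero]
    have hg : E γ γ = 0 := by rw [hEE, P.br_self, map_zero]
    rw [hl, hr, hr, hg, hskew γ x] at hb
    apply (hu.mul hu).mul_left_cancel
    linear_combination hb
  let J (x y z : H) : H := E x (E y z) - E (E x y) z - E y (E x z)
  have hJ1 : ∀ x y z, J x y z = 0 → J x z y = 0 := by
    intro x y z h
    simp only [J] at h ⊢
    rw [hskew z y, map_neg, hskew (E x z) y, hskew z (E x y)]
    linear_combination -h
  have hJ2 : ∀ x y z, J x y z = 0 → J z x y = 0 := by
    intro x y z h
    simp only [J] at h ⊢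
    rw [hskew z (E x y), hskew z x, map_neg, hskew z y, map_neg,
      Derivation.neg_apply, hskew (E x z) y]
    linear_combination h
  have hJder : ∀ x y, (∀ c, J x y (algebraMap B H c) = 0) → ∀ z, J x y z = 0 := by
    intro x y h
    refine key _ h (fun z g hg hu hzg => ?_)
    apply hu.mul_left_cancel
    simp only [J] at hg hzg ⊢
    simp only [hr, map_add] at hzg
    linear_combination hzg - z * hg
  have hJ0 : ∀ a b z, J (algebraMap B H a) (algebraMap B H b) z = 0 := by
    intro a b
    refine hJder _ _ (fun c => ?_)
    simp only [J, hEE]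
    rw [P.jacobi, map_add]; ring
  have hJ3 : ∀ a y z, J (algebraMap B H a) y z = 0 := by
    intro a y
    exact hJder _ _ (fun c => hJ1 _ _ _ (hJ0 a c y))
  have hJ : ∀ x y z, J x y z = 0 := by
    intro x y
    refine hJder _ _ (fun c => ?_)
    exact hJ2 _ _ _ (hJ2 _ _ _ (hJ3 c x y))
  refine ⟨⟨LinearMap.mk₂ k (fun x y => E x y) ?_ ?_ ?_ ?_, hself, ?_, hr⟩, hEE⟩
  · intro x y z; simp
  · intro c x y; simp
  · intro x y z; simp
  · intro c x y; simp
  · intro x y z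
    have := hJ x y z
    simp only [J] at this
    simp only [LinearMap.mk₂_apply]
    linear_combination this

/-- An algebra map out of a localization is Poisson if its restriction is. -/
theorem isPoissonHom_of_loc (G : Submonoid B) [IsLocalization G H]
    {R : Type w} [CommRing R] [Algebra k R] (P : PoissonStr k B)
    (Q : PoissonStr k H) (hQ : ∀ a b, Q.br (algebraMap B H a) (algebraMap B H b)
      = algebraMap B H (P.br a b)) (T : PoissonStr k R) (φ : H →ₐ[k] R)
    (h : ∀ a b, φ (algebraMap B H (P.br a b)) =
      T.br (φ (algebraMap B H a)) (φ (algebraMap B H b))) : IsPoissonHom Q T φ := by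
  have key : ∀ p : H → Prop, (∀ b, p (algebraMap B H b)) →
      (∀ x g, p g → IsUnit g → p (x * g) → p x) → ∀ x, p x := by
    intro p h1 h2 x
    obtain ⟨⟨b, g⟩, hx⟩ := IsLocalization.surj G x
    exact h2 x _ (h1 g) (IsLocalization.map_units H g) (hx ▸ h1 b)
  have h0 : ∀ a y, φ (Q.br (algebraMap B H a) y) = T.br (φ (algebraMap B H a)) (φ y) := by
    intro a
    refine key _ (fun b => by rw [hQ, h]) (fun x g hg hu hxg => ?_)
    rw [map_mul φ x g, Q.leibniz, T.leibniz, map_add, map_mul, map_mul, hg] at hxg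
    apply (hu.map φ).mul_left_cancel
    linear_combination hxg
  intro x y
  refine key (fun x => φ (Q.br x y) = T.br (φ x) (φ y)) (fun a => h0 a y)
    (fun x g hg hu hxg => ?_) x
  rw [map_mul φ x g, Q.leibniz_left, T.leibniz_left, map_add, map_mul, map_mul, hg] at hxg
  apply (hu.map φ).mul_left_cancel
  linear_combination hxg

end PoissonPart

section CoalgPart

/-- Over a field every tensor has a representation with independent families on both sides. -/
lemma exists_indep_repr {k : Type u} [Field k] {M : Type v} {N : Type w} [AddCommGroup M]
    [Module k M] [AddCommGroup N] [Module k N] (x : M ⊗[k] N) :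
    ∃ (n : ℕ) (a : Fin n → M) (b : Fin n → N), LinearIndependent k a ∧ LinearIndependent k b ∧
      x = ∑ i, a i ⊗ₜ[k] b i := by
  classical
  have hex : ∃ n : ℕ, ∃ (a : Fin n → M) (b : Fin n → N), x = ∑ i, a i ⊗ₜ[k] b i := by
    induction x with
    | zero => exact ⟨0, Fin.elim0, Fin.elim0, by simp⟩
    | tmul p q => exact ⟨1, fun _ => p, fun _ => q, by simp⟩
    | add x y hx hy =>
      obtain ⟨n, a, b, rfl⟩ := hx
      obtain ⟨m, a', b', rfl⟩ := hy
      exact ⟨n + m, Fin.append a a', Fin.append b b', by simp [Fin.sum_univ_add]⟩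
  obtain ⟨a, b, hx⟩ := Nat.find_spec hex
  have hmin := fun m => Nat.find_min hex (m := m)
  generalize Nat.find hex = n at a b hx hmin
  refine ⟨n, a, b, ?_, ?_, hx⟩
  · by_contra hli
    rw [Fintype.not_linearIndependent_iff] at hli
    obtain ⟨g, hg, i, hi⟩ := hli
    cases n with
    | zero => exact i.elim0
    | succ n =>
      refine hmin n (Nat.lt_succ_self n) ⟨fun j => a (i.succAbove j),
        fun j => b (i.succAbove j) - (g (i.succAbove j) / g i) • b i, ?_⟩
      rw [Fin.sum_univ_succAbove _ i] at hg hx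
      have hai : a i = - ∑ j, (g (i.succAbove j) / g i) • a (i.succAbove j) := by
        have : a i = (g i)⁻¹ • (g i • a i) := by rw [smul_smul, inv_mul_cancel₀ hi, one_smul]
        rw [this, eq_neg_of_add_eq_zero_left hg, smul_neg, Finset.smul_sum]
        simp [smul_smul, div_eq_inv_mul]
      rw [hx]
      conv_lhs => rw [hai]
      simp only [TensorProduct.neg_tmul, TensorProduct.sum_tmul, TensorProduct.tmul_sub,
        Finset.sum_sub_distrib, TensorProduct.smul_tmul]
      abel
  · by_contra hli
    rw [Fintype.not_linearIndependent_iff] at hli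
    obtain ⟨g, hg, i, hi⟩ := hli
    cases n with
    | zero => exact i.elim0
    | succ n =>
      refine hmin n (Nat.lt_succ_self n) ⟨fun j => a (i.succAbove j)
        - (g (i.succAbove j) / g i) • a i, fun j => b (i.succAbove j), ?_⟩
      rw [Fin.sum_univ_succAbove _ i] at hg hx
      have hbi : b i = - ∑ j, (g (i.succAbove j) / g i) • b (i.succAbove j) := by
        have : b i = (g i)⁻¹ • (g i • b i) := by rw [smul_smul, inv_mul_cancel₀ hi, one_smul]
        rw [this, eq_neg_of_add_eq_zero_left hg, smul_neg, Finset.smul_sum]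
        simp [smul_smul, div_eq_inv_mul]
      rw [hx]
      conv_lhs => rw [hbi]
      simp only [TensorProduct.tmul_neg, TensorProduct.tmul_sum, TensorProduct.sub_tmul,
        Finset.sum_sub_distrib, TensorProduct.smul_tmul]
      abel

lemma exists_dual_family {k : Type u} [Field k] {M : Type v} [AddCommGroup M]
    [Module k M] {n : ℕ} (a : Fin n → M) (ha : LinearIndependent k a) :
    ∃ φ : Fin n → (M →ₗ[k] k), ∀ i j, φ i (a j) = if j = i then 1 else 0 := by
  classical
  have hb := (Module.Basis.span ha)
  choose φ hφ using fun i => LinearMap.exists_extend ((Module.Basis.span ha).coord i)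
  refine ⟨φ, fun i j => ?_⟩
  have h1 := LinearMap.congr_fun (hφ i) (Module.Basis.span ha j)
  simp only [LinearMap.comp_apply, Submodule.subtype_apply, Module.Basis.span_apply] at h1
  rw [h1]
  simp [Module.Basis.coord_apply, Finsupp.single_apply]

/-- A comatrix over a bialgebra. -/
structure IsComatrix {k : Type u} {B : Type v} [CommRing k] [CommRing B] [Algebra k B]
    (D : BialgData k B) {ι : Type} [Fintype ι] [DecidableEq ι] (c : Matrix ι ι B) : Prop where
  comul : ∀ i j, D.comul (c i j) = ∑ l, c i l ⊗ₜ[k] c l j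
  counit : ∀ i j, D.counit (c i j) = if i = j then 1 else 0

lemma rid_assoc_aux {k : Type u} {B : Type v} [CommRing k] [CommRing B] [Algebra k B]
    (φ : B →ₗ[k] k) (v : B) (t : B ⊗[k] B) :
    TensorProduct.rid k (B ⊗[k] B) (TensorProduct.map LinearMap.id φ
      ((TensorProduct.assoc k B B B).symm (v ⊗ₜ[k] t))) =
    v ⊗ₜ[k] TensorProduct.rid k B (TensorProduct.map LinearMap.id φ t) := by
  induction t with
  | zero => simp
  | add x y hx hy => simp only [TensorProduct.tmul_add, map_add, hx, hy]
  | tmul p q => simp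

/-- The fundamental theorem of coalgebras, in comatrix form. -/
theorem exists_comatrix {k : Type u} {B : Type v} [Field k] [CommRing B] [Algebra k B]
    (D : BialgData k B) (b : B) :
    ∃ (n : ℕ) (c : Matrix (Fin n) (Fin n) B) (L : Matrix (Fin n) (Fin n) k),
      IsComatrix D c ∧ b = ∑ i, ∑ j, L i j • c i j := by
  classical
  obtain ⟨n, a, w, ha, hw, hb⟩ := exists_indep_repr (D.comul b)
  obtain ⟨φ, hφ⟩ := exists_dual_family w hw
  obtain ⟨ψ, hψ⟩ := exists_dual_family a ha
  let c : Matrix (Fin n) (Fin n) B := fun i j =>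
    TensorProduct.rid k B (TensorProduct.map LinearMap.id (φ j) (D.comul (w i)))
  have hda : ∀ j, D.comul (a j) = ∑ i, a i ⊗ₜ[k] c i j := by
    intro j
    have h1 := D.coassoc b
    rw [hb] at h1
    simp only [map_sum, TensorProduct.map_tmul, AlgHom.toLinearMap_apply, LinearMap.id_apply] at h1
    have h2 := congrArg (fun t => TensorProduct.rid k (B ⊗[k] B)
      (TensorProduct.map LinearMap.id (φ j) t)) h1
    simp only [map_sum, rid_assoc_aux] at h2
    simpa [hφ] using h2
  have haj : ∀ j, a j = ∑ i, D.counit (a i) • c i j := by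
    intro j
    have h1 := D.counit_comul (a j)
    rw [hda] at h1
    simpa using h1.symm
  have hε : ∀ i j, D.counit (c i j) = if i = j then 1 else 0 := by
    intro m j
    have h1 := D.comul_counit (a j)
    rw [hda] at h1
    have h2 := congrArg (ψ m) h1
    simp [hψ] at h2
    rw [h2]
    simp [eq_comm]
  have hbb : b = ∑ j, D.counit (w j) • a j := by
    have h1 := D.comul_counit b
    rw [hb] at h1
    simpa using h1.symm
  refine ⟨n, c, fun i j => D.counit (w j) * D.counit (a i), ⟨fun m j => ?_, hε⟩, ?_⟩
  · have h1 := congrArg (TensorProduct.assoc k B B B) (D.coassoc (a j))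
    rw [LinearEquiv.apply_symm_apply, hda] at h1
    simp only [map_sum, TensorProduct.map_tmul, AlgHom.toLinearMap_apply, LinearMap.id_apply,
      hda, TensorProduct.sum_tmul, TensorProduct.assoc_tmul] at h1
    have h2 := congrArg (fun t => TensorProduct.lid k (B ⊗[k] B)
      (TensorProduct.map (ψ m) LinearMap.id t)) h1
    simp only [map_sum, TensorProduct.map_tmul, LinearMap.id_apply, hψ,
      TensorProduct.lid_tmul, ite_smul, one_smul, zero_smul, Finset.sum_ite_eq',
      Finset.mem_univ, if_true] at h2
    exact h2.symm
  · conv_lhs => rw [hbb]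
    rw [Finset.sum_comm]
    refine Finset.sum_congr rfl fun j _ => ?_
    conv_lhs => rw [haj]
    simp [Finset.smul_sum, mul_smul]

/-- Group-like elements. -/
def groupLikes {k : Type u} {B : Type v} [CommRing k] [CommRing B] [Algebra k B]
    (D : BialgData k B) : Submonoid B where
  carrier := {g | D.comul g = g ⊗ₜ[k] g ∧ D.counit g = 1}
  one_mem' := ⟨by rw [map_one]; rfl, map_one _⟩
  mul_mem' := by
    rintro a b ⟨h1, h2⟩ ⟨h3, h4⟩
    exact ⟨by rw [map_mul, h1, h3, Algebra.TensorProduct.tmul_mul_tmul], by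
      rw [map_mul, h2, h4, one_mul]⟩

lemma det_mem_groupLikes {k : Type u} {B : Type v} [CommRing k] [CommRing B] [Algebra k B]
    (D : BialgData k B) {ι : Type} [Fintype ι] [DecidableEq ι] (c : Matrix ι ι B)
    (hc : IsComatrix D c) : c.det ∈ groupLikes D := by
  constructor
  · let l : B →ₐ[k] B ⊗[k] B := Algebra.TensorProduct.includeLeft
    let r : B →ₐ[k] B ⊗[k] B := Algebra.TensorProduct.includeRight
    have h : D.comul.mapMatrix c = l.mapMatrix c * r.mapMatrix c := by
      ext i j
      simp [hc.comul, Matrix.mul_apply, l, r]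
    rw [AlgHom.map_det, h, Matrix.det_mul, ← AlgHom.map_det, ← AlgHom.map_det]
    simp [l, r]
  · have h : D.counit.mapMatrix c = 1 := by
      ext i j
      simp [hc.counit, Matrix.one_apply]
    rw [AlgHom.map_det, h, Matrix.det_one]

/-- Convolution powers of the identity. -/
noncomputable def convPow {k : Type u} {H : Type v} [CommRing k] [CommRing H] [Algebra k H]
    (D : BialgData k H) : ℕ → (H →ₗ[k] H)
  | 0 => Algebra.linearMap k H ∘ₗ D.counit.toLinearMap
  | n + 1 => LinearMap.mul' k H ∘ₗ TensorProduct.map (convPow D n) LinearMap.id ∘ₗ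
      D.comul.toLinearMap

lemma convPow_entry {k : Type u} {H : Type v} [CommRing k] [CommRing H] [Algebra k H]
    (D : BialgData k H) {ι : Type} [Fintype ι] [DecidableEq ι] (c : Matrix ι ι H)
    (hc : IsComatrix D c) (m : ℕ) : ∀ i j, convPow D m (c i j) = (c ^ m) i j := by
  induction m with
  | zero =>
    intro i j
    simp only [convPow, LinearMap.comp_apply, AlgHom.toLinearMap_apply, hc.counit, pow_zero,
      Matrix.one_apply]
    split_ifs <;> simp
  | succ m ih =>
    intro i j
    simp [convPow, hc.comul, ih, pow_succ, Matrix.mul_apply]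

/-- Well-definedness of the candidate antipode. -/
lemma inv_comb_eq_zero {k : Type u} {H : Type v} [CommRing k] [CommRing H] [Algebra k H]
    (D : BialgData k H) {ι : Type} [Fintype ι] [DecidableEq ι] (c c' : Matrix ι ι H)
    (hc : IsComatrix D c) (hcc : c * c' = 1) (L : Matrix ι ι k)
    (h : ∑ i, ∑ j, L i j • c i j = 0) : ∑ i, ∑ j, L i j • c' i j = 0 := by
  let ℓ : Matrix ι ι H →ₗ[H] H := ∑ i, ∑ j, algebraMap k H (L i j) • Matrix.entryLinearMap H H i j
  have hℓ : ∀ M, ℓ M = ∑ i, ∑ j, L i j • M i j := by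
    intro M
    simp [ℓ, LinearMap.sum_apply, Algebra.smul_def]
  have hpow : ∀ m, ℓ (c ^ m) = 0 := by
    intro m
    rw [hℓ]
    have := congrArg (convPow D m) h
    simpa only [map_sum, map_smul, convPow_entry D c hc, map_zero] using this
  have hpoly : ∀ p : Polynomial H, ℓ (Polynomial.aeval c p) = 0 := by
    intro p
    rw [Polynomial.aeval_eq_sum_range]
    simp [hpow]
  have hdet : IsUnit c.det := by
    have := congrArg Matrix.det hcc
    rw [Matrix.det_mul, Matrix.det_one] at this
    exact IsUnit.of_mul_eq_one _ this
  rw [Matrix.det_eq_sign_charpoly_coeff] at hdet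
  have hu := isUnit_of_mul_isUnit_right hdet
  have hCH := Matrix.aeval_self_charpoly c
  rw [← Polynomial.divX_mul_X_add c.charpoly, map_add, map_mul, Polynomial.aeval_X,
    Polynomial.aeval_C, Algebra.algebraMap_eq_smul_one] at hCH
  have h2 := congrArg (fun M => ℓ (M * c')) hCH
  simp only [add_mul, mul_assoc, hcc, mul_one, smul_mul_assoc, one_mul, zero_mul, map_add,
    map_smul, hpoly, zero_add, map_zero, smul_eq_mul] at h2
  rw [← hℓ]
  exact (hu.mul_right_eq_zero).1 h2

/-- The graph of the antipode. -/
def AntiRel {k : Type u} {H : Type v} [CommRing k] [CommRing H] [Algebra k H]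
    (D : BialgData k H) (h s : H) : Prop :=
  ∃ (ι : Type) (_ : Fintype ι) (_ : DecidableEq ι) (c c' : Matrix ι ι H) (L : Matrix ι ι k),
    IsComatrix D c ∧ c * c' = 1 ∧ h = ∑ i, ∑ j, L i j • c i j ∧ s = ∑ i, ∑ j, L i j • c' i j

lemma AntiRel.add {k : Type u} {H : Type v} [CommRing k] [CommRing H] [Algebra k H]
    {D : BialgData k H} {h s h' s' : H} (h1 : AntiRel D h s) (h2 : AntiRel D h' s') :
    AntiRel D (h + h') (s + s') := by
  obtain ⟨ι, _, _, c, c', L, hc, hcc, rfl, rfl⟩ := h1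
  obtain ⟨κ, _, _, d, d', M, hd, hdd, rfl, rfl⟩ := h2
  refine ⟨ι ⊕ κ, inferInstance, inferInstance, Matrix.fromBlocks c 0 0 d,
    Matrix.fromBlocks c' 0 0 d', Matrix.fromBlocks L 0 0 M, ⟨?_, ?_⟩, ?_, ?_, ?_⟩
  · rintro (i | i) (j | j) <;> simp [hc.comul, hd.comul]
  · rintro (i | i) (j | j) <;> simp [hc.counit, hd.counit]
  · simp [Matrix.fromBlocks_multiply, hcc, hdd]
  · simp
  · simp

lemma AntiRel.smul {k : Type u} {H : Type v} [CommRing k] [CommRing H] [Algebra k H]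
    {D : BialgData k H} {h s : H} (r : k) (h1 : AntiRel D h s) :
    AntiRel D (r • h) (r • s) := by
  obtain ⟨ι, _, _, c, c', L, hc, hcc, rfl, rfl⟩ := h1
  exact ⟨ι, _, _, c, c', r • L, hc, hcc, by simp [Finset.smul_sum, mul_smul],
    by simp [Finset.smul_sum, mul_smul]⟩

lemma AntiRel.unique {k : Type u} {H : Type v} [CommRing k] [CommRing H] [Algebra k H]
    {D : BialgData k H} {h s s' : H} (h1 : AntiRel D h s) (h2 : AntiRel D h s') : s = s' := by
  have h3 := h1.add (h2.smul (-1))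
  rw [neg_one_smul, neg_one_smul, add_neg_cancel] at h3
  obtain ⟨ι, _, _, c, c', L, hc, hcc, h0, hs⟩ := h3
  rw [inv_comb_eq_zero D c c' hc hcc L h0.symm] at hs
  linear_combination hs

lemma AntiRel.entry {k : Type u} {H : Type v} [CommRing k] [CommRing H] [Algebra k H]
    {D : BialgData k H} {ι : Type} [Fintype ι] [DecidableEq ι] (c c' : Matrix ι ι H)
    (hc : IsComatrix D c) (hcc : c * c' = 1) (i j : ι) : AntiRel D (c i j) (c' i j) := by
  refine ⟨ι, _, _, c, c', fun a b => if a = i then (if b = j then 1 else 0) else 0, hc, hcc,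
    ?_, ?_⟩ <;> simp [ite_smul, Finset.sum_ite_eq']

theorem exists_antipode {k : Type u} {H : Type v} [CommRing k] [CommRing H] [Algebra k H]
    (D : BialgData k H) (htot : ∀ h, ∃ s, AntiRel D h s) :
    ∃ K : HopfData k H, K.toBialgData = D := by
  choose S hS using htot
  let S' : H →ₗ[k] H :=
    { toFun := S
      map_add' := fun a b => (hS (a + b)).unique ((hS a).add (hS b))
      map_smul' := fun r a => (hS (r • a)).unique ((hS a).smul r) }
  have hS' : ∀ h, S' h = S h := fun _ => rfl
  refine ⟨⟨D, S', ?_, ?_⟩, rfl⟩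
  · intro b
    obtain ⟨ι, _, _, c, c', L, hc, hcc, rfl, -⟩ := hS b
    have hcc' : c' * c = 1 := mul_eq_one_comm.1 hcc
    have he : ∀ i j, S' (c i j) = c' i j := fun i j =>
      (hS _).unique (AntiRel.entry c c' hc hcc i j)
    simp only [map_sum, map_smul, hc.comul, hc.counit, TensorProduct.map_tmul, he,
      LinearMap.id_apply, LinearMap.mul'_apply]
    refine Finset.sum_congr rfl fun i _ => Finset.sum_congr rfl fun j _ => ?_
    rw [← Matrix.mul_apply, hcc', Matrix.one_apply, Algebra.smul_def, smul_eq_mul, map_mul]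
    split_ifs <;> simp
  · intro b
    obtain ⟨ι, _, _, c, c', L, hc, hcc, rfl, -⟩ := hS b
    have he : ∀ i j, S' (c i j) = c' i j := fun i j =>
      (hS _).unique (AntiRel.entry c c' hc hcc i j)
    simp only [map_sum, map_smul, hc.comul, hc.counit, TensorProduct.map_tmul, he,
      LinearMap.id_apply, LinearMap.mul'_apply]
    refine Finset.sum_congr rfl fun i _ => Finset.sum_congr rfl fun j _ => ?_
    rw [← Matrix.mul_apply, hcc, Matrix.one_apply, Algebra.smul_def, smul_eq_mul, map_mul]
    split_ifs <;> simp

end CoalgPart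

section LocPart

lemma algHom_ext_loc {k : Type u} [CommRing k] {B H : Type v} [CommRing B] [Algebra k B]
    [CommRing H] [Algebra k H] [Algebra B H] (G : Submonoid B)
    [IsLocalization G H] {R : Type w} [CommRing R] [Algebra k R] (f g : H →ₐ[k] R)
    (h : ∀ b, f (algebraMap B H b) = g (algebraMap B H b)) : f = g := by
  have : f.toRingHom = g.toRingHom := IsLocalization.ringHom_ext G (RingHom.ext h)
  ext x
  exact RingHom.congr_fun this x

lemma assoc_nat {k : Type u} [CommRing k] {B H : Type v} [CommRing B] [Algebra k B]
    [CommRing H] [Algebra k H] (η : B →ₐ[k] H) (a : B) (t : B ⊗[k] B) :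
    (TensorProduct.assoc k H H H).symm (η a ⊗ₜ[k] Algebra.TensorProduct.map η η t) =
    TensorProduct.map (Algebra.TensorProduct.map η η).toLinearMap η.toLinearMap
      ((TensorProduct.assoc k B B B).symm (a ⊗ₜ[k] t)) := by
  induction t with
  | zero => simp
  | add x y hx hy => simp only [TensorProduct.tmul_add, map_add, hx, hy]
  | tmul p q => simp

/-- The bialgebra structure on the localization at group-likes. -/
theorem exists_bialg_loc {k : Type u} [CommRing k] {B H : Type v} [CommRing B] [Algebra k B]
    [CommRing H] [Algebra k H] [Algebra B H] [IsScalarTower k B H] (D : BialgData k B)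
    [IsLocalization (groupLikes D) H] (η : B →ₐ[k] H) (hη : ∀ b, η b = algebraMap B H b) :
    ∃ E : BialgData k H, (∀ b, E.comul (η b) = Algebra.TensorProduct.map η η (D.comul b)) ∧
      ∀ b, E.counit (η b) = D.counit b := by
  have hunit : ∀ g : groupLikes D, IsUnit (η g) := fun g => by
    rw [hη]; exact IsLocalization.map_units H g
  have hf : ∀ g : groupLikes D, IsUnit (((Algebra.TensorProduct.map η η).comp D.comul) g) := by
    intro g
    have h1 : D.comul g = (g : B) ⊗ₜ[k] (g : B) := g.2.1
    rw [AlgHom.comp_apply, h1, Algebra.TensorProduct.map_tmul, tmul_split]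
    exact ((hunit g).map _).mul ((hunit g).map _)
  have hg : ∀ g : groupLikes D, IsUnit (D.counit g) := by
    intro g
    have h1 : D.counit g = 1 := g.2.2
    rw [h1]; exact isUnit_one
  let Δ : H →ₐ[k] H ⊗[k] H := IsLocalization.liftAlgHom (M := groupLikes D) hf
  let ε : H →ₐ[k] k := IsLocalization.liftAlgHom (M := groupLikes D) hg
  have hΔ : ∀ b, Δ (η b) = Algebra.TensorProduct.map η η (D.comul b) := by
    intro b; rw [hη]; simp [Δ]
  have hε : ∀ b, ε (η b) = D.counit b := by
    intro b; rw [hη]; simp [ε]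
  refine ⟨⟨Δ, ε, ?_, ?_, ?_⟩, hΔ, hε⟩
  · have key : (Algebra.TensorProduct.map Δ (AlgHom.id k H)).comp Δ =
        (Algebra.TensorProduct.assoc k k k H H H).symm.toAlgHom.comp
          ((Algebra.TensorProduct.map (AlgHom.id k H) Δ).comp Δ) := by
      refine algHom_ext_loc (groupLikes D) _ _ (fun b => ?_)
      rw [← hη]
      change TensorProduct.map Δ.toLinearMap LinearMap.id (Δ (η b)) =
        (TensorProduct.assoc k H H H).symm
          (TensorProduct.map LinearMap.id Δ.toLinearMap (Δ (η b)))
      rw [hΔ]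
      have h1 : ∀ t : B ⊗[k] B, TensorProduct.map Δ.toLinearMap LinearMap.id
          (Algebra.TensorProduct.map η η t) =
          TensorProduct.map (Algebra.TensorProduct.map η η).toLinearMap η.toLinearMap
            (TensorProduct.map D.comul.toLinearMap LinearMap.id t) := by
        intro t
        induction t with
        | zero => simp
        | add x y hx hy => simp only [map_add, hx, hy]
        | tmul p q =>
          simp [hΔ]
          rfl
      have h2 : ∀ t : B ⊗[k] B, (TensorProduct.assoc k H H H).symm
          (TensorProduct.map LinearMap.id Δ.toLinearMap (Algebra.TensorProduct.map η η t)) =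
          TensorProduct.map (Algebra.TensorProduct.map η η).toLinearMap η.toLinearMap
            ((TensorProduct.assoc k B B B).symm
              (TensorProduct.map LinearMap.id D.comul.toLinearMap t)) := by
        intro t
        induction t with
        | zero => simp
        | add x y hx hy => simp only [map_add, hx, hy]
        | tmul p q =>
          simp only [Algebra.TensorProduct.map_tmul, TensorProduct.map_tmul, LinearMap.id_apply,
            AlgHom.toLinearMap_apply, hΔ, assoc_nat]
      rw [h1, h2, D.coassoc]
    intro b
    exact DFunLike.congr_fun key b
  · have key : (Algebra.TensorProduct.lid k H).toAlgHom.comp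
        ((Algebra.TensorProduct.map ε (AlgHom.id k H)).comp Δ) = AlgHom.id k H := by
      refine algHom_ext_loc (groupLikes D) _ _ (fun b => ?_)
      rw [← hη]
      change TensorProduct.lid k H (TensorProduct.map ε.toLinearMap LinearMap.id (Δ (η b))) = η b
      rw [hΔ]
      have h1 : ∀ t : B ⊗[k] B, TensorProduct.lid k H (TensorProduct.map ε.toLinearMap LinearMap.id
          (Algebra.TensorProduct.map η η t)) = η (TensorProduct.lid k B
            (TensorProduct.map D.counit.toLinearMap LinearMap.id t)) := by
        intro t
        induction t with
        | zero => simp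
        | add x y hx hy => simp only [map_add, hx, hy]
        | tmul p q => simp [hε]
      rw [h1, D.counit_comul]
    intro b
    exact DFunLike.congr_fun key b
  · have key : (Algebra.TensorProduct.rid k k H).toAlgHom.comp
        ((Algebra.TensorProduct.map (AlgHom.id k H) ε).comp Δ) = AlgHom.id k H := by
      refine algHom_ext_loc (groupLikes D) _ _ (fun b => ?_)
      rw [← hη]
      change TensorProduct.rid k H (TensorProduct.map LinearMap.id ε.toLinearMap (Δ (η b))) = η b
      rw [hΔ]
      have h1 : ∀ t : B ⊗[k] B, TensorProduct.rid k H (TensorProduct.map LinearMap.id ε.toLinearMap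
          (Algebra.TensorProduct.map η η t)) = η (TensorProduct.rid k B
            (TensorProduct.map LinearMap.id D.counit.toLinearMap t)) := by
        intro t
        induction t with
        | zero => simp
        | add x y hx hy => simp only [map_add, hx, hy]
        | tmul p q => simp [hε]
      rw [h1, D.comul_counit]
    intro b
    exact DFunLike.congr_fun key b

/-- Every element of the localization is covered by an invertible comatrix. -/
theorem antiRel_total {k : Type u} [Field k] {B H : Type v} [CommRing B] [Algebra k B]
    [CommRing H] [Algebra k H] [Algebra B H] (D : BialgData k B)
    [IsLocalization (groupLikes D) H] (η : B →ₐ[k] H) (hη : ∀ b, η b = algebraMap B H b)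
    (E : BialgData k H) (hΔ : ∀ b, E.comul (η b) = Algebra.TensorProduct.map η η (D.comul b))
    (hε : ∀ b, E.counit (η b) = D.counit b) (h : H) : ∃ s, AntiRel E h s := by
  obtain ⟨⟨b, g⟩, hx⟩ := IsLocalization.surj (groupLikes D) h
  simp only [← hη] at hx
  have hu : IsUnit (η g) := by rw [hη]; exact IsLocalization.map_units H g
  obtain ⟨γ, hγ⟩ := hu.exists_right_inv
  have hg1 : E.comul (η g) = η g ⊗ₜ[k] η g := by
    have h1 : D.comul g = (g : B) ⊗ₜ[k] (g : B) := g.2.1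
    rw [hΔ, h1, Algebra.TensorProduct.map_tmul]
  have hg2 : E.counit (η g) = 1 := by
    have h1 : D.counit g = 1 := g.2.2
    rw [hε, h1]
  have hγ1 : E.comul γ = γ ⊗ₜ[k] γ := by
    have h1 : E.comul (η g) * E.comul γ = 1 := by rw [← map_mul, hγ, map_one]
    have h2 : (γ ⊗ₜ[k] γ) * E.comul (η g) = 1 := by
      rw [hg1, Algebra.TensorProduct.tmul_mul_tmul, mul_comm γ, hγ]; rfl
    exact (left_inv_eq_right_inv h2 h1).symm
  have hγ2 : E.counit γ = 1 := by
    have h1 := congrArg E.counit hγ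
    rwa [map_mul, hg2, one_mul, map_one] at h1
  obtain ⟨n, c, L, hc, hb⟩ := exists_comatrix D b
  have hdet := det_mem_groupLikes D c hc
  have hdu : IsUnit (η.mapMatrix c).det := by
    rw [← AlgHom.map_det, hη]
    exact IsLocalization.map_units H (⟨_, hdet⟩ : groupLikes D)
  refine ⟨∑ i, ∑ j, L i j • (η g • (η.mapMatrix c)⁻¹) i j, Fin n, inferInstance, inferInstance,
    γ • η.mapMatrix c, η g • (η.mapMatrix c)⁻¹, L, ⟨?_, ?_⟩, ?_, ?_, rfl⟩
  · intro i j
    simp only [Matrix.smul_apply, AlgHom.mapMatrix_apply, Matrix.map_apply, smul_eq_mul, map_mul,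
      hγ1, hΔ, hc.comul, map_sum, Algebra.TensorProduct.map_tmul, Finset.mul_sum,
      Algebra.TensorProduct.tmul_mul_tmul]
  · intro i j
    simp only [Matrix.smul_apply, AlgHom.mapMatrix_apply, Matrix.map_apply, smul_eq_mul, map_mul,
      hγ2, hε, hc.counit, one_mul]
  · rw [smul_mul_assoc, mul_smul_comm, Matrix.mul_nonsing_inv _ hdu, smul_smul, mul_comm, hγ,
      one_smul]
  · have : h = γ * η b := by
      rw [← hx]; linear_combination -h * hγ
    rw [this, hb]
    simp only [map_sum, map_smul, Finset.mul_sum, Matrix.smul_apply, AlgHom.mapMatrix_apply,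
      Matrix.map_apply, smul_eq_mul, mul_smul_comm]

/-- Bialgebra maps to Hopf algebras send group-likes to units. -/
lemma isUnit_of_groupLike {k : Type u} [CommRing k] {B : Type v} {K : Type w} [CommRing B]
    [Algebra k B] [CommRing K] [Algebra k K] (D : BialgData k B) (E : HopfData k K)
    (f : B →ₐ[k] K)
    (h1 : ∀ a, E.comul (f a) = TensorProduct.map f.toLinearMap f.toLinearMap (D.comul a))
    (h2 : ∀ a, E.counit (f a) = D.counit a) (g : groupLikes D) : IsUnit (f g) := by
  have e1 : D.comul g = (g : B) ⊗ₜ[k] (g : B) := g.2.1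
  have e2 : D.counit g = 1 := g.2.2
  have h3 := E.comul_antipode (f g)
  rw [h1, h2, e1, e2] at h3
  simp only [TensorProduct.map_tmul, AlgHom.toLinearMap_apply, LinearMap.id_apply,
    LinearMap.mul'_apply, map_one] at h3
  exact IsUnit.of_mul_eq_one _ h3

end LocPart

/-- the forgetful functor from Poisson Hopf algebras to Poisson
bialgebras has a left adjoint; in particular Poisson Hopf algebras form a reflective
subcategory of Poisson bialgebras. -/
theorem free_poisson_hopf_on_bialg (k : Type u) [Field k]
    (B : PoissonBialgBundle.{u, u} k) :
    ∃ (H : PoissonHopfBundle.{u, u} k) (η : B.carrier →ₐ[k] H.carrier),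
      IsPoissonBialgHom B.str H.str B.bi H.hopf.toBialgData η ∧
      ∀ (K : PoissonHopfBundle.{u, u} k) (f : B.carrier →ₐ[k] K.carrier),
        IsPoissonBialgHom B.str K.str B.bi K.hopf.toBialgData f →
        ∃! g : H.carrier →ₐ[k] K.carrier,
          IsPoissonBialgHom H.str K.str H.hopf.toBialgData K.hopf.toBialgData g ∧
          ∀ b : B.carrier, g (η b) = f b := by
  let G := groupLikes B.bi
  let L := Localization G
  let η : B.carrier →ₐ[k] L := IsScalarTower.toAlgHom k B.carrier L
  have hη : ∀ b, η b = algebraMap B.carrier L b := fun _ => rfl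
  obtain ⟨Q, hQ⟩ := exists_poisson_loc L G B.str
  obtain ⟨E, hΔ, hε⟩ := exists_bialg_loc B.bi η hη
  obtain ⟨S, rfl⟩ := exists_antipode E (antiRel_total B.bi η hη E hΔ hε)
  have hηP : IsPoissonHom B.str Q η := fun a b => by rw [hη, hη, hη, hQ]
  have hcompat : IsPoissonBialg Q S.toBialgData := by
    obtain ⟨T, hT, hTc⟩ := B.compat
    refine ⟨tensorPoisson Q Q, tensorPoisson_isTensor Q Q, ?_⟩
    refine isPoissonHom_of_loc G B.str Q hQ (tensorPoisson Q Q) S.comul (fun a b => ?_)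
    rw [← hη, ← hη, ← hη, hΔ, hΔ, hΔ, hTc]
    exact tensorPoisson_map B.str Q η hηP T _ hT (tensorPoisson_isTensor Q Q) _ _
  refine ⟨{ carrier := L, str := Q, hopf := S, compat := hcompat }, η, ⟨hηP, hΔ, hε⟩, ?_⟩
  rintro K f ⟨hf1, hf2, hf3⟩
  have hu := isUnit_of_groupLike B.bi K.hopf f hf2 hf3
  let g : L →ₐ[k] K.carrier := IsLocalization.liftAlgHom (M := G) hu
  have hg : ∀ b, g (η b) = f b := by
    intro b; rw [hη]; simp [g]
  refine ⟨g, ⟨⟨?_, ?_, ?_⟩, hg⟩, ?_⟩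
  · refine isPoissonHom_of_loc G B.str Q hQ K.str g (fun a b => ?_)
    rw [← hη, ← hη, ← hη, hg, hg, hg, hf1]
  · have key : K.hopf.comul.comp g = (Algebra.TensorProduct.map g g).comp S.comul := by
      refine algHom_ext_loc G _ _ (fun b => ?_)
      rw [← hη, AlgHom.comp_apply, AlgHom.comp_apply, hg, hΔ, hf2]
      have : ∀ t : B.carrier ⊗[k] B.carrier, TensorProduct.map f.toLinearMap f.toLinearMap t =
          Algebra.TensorProduct.map g g (Algebra.TensorProduct.map η η t) := by
        intro t
        induction t with
        | zero => simp
        | add x y hx hy => simp only [map_add, hx, hy]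
        | tmul p q => simp [hg]
      exact this _
    intro a
    exact DFunLike.congr_fun key a
  · have key : K.hopf.counit.comp g = S.counit := by
      refine algHom_ext_loc G _ _ (fun b => ?_)
      rw [← hη, AlgHom.comp_apply, hg, hε, hf3]
    intro a
    exact DFunLike.congr_fun key a
  · rintro g' ⟨-, hg'⟩
    refine algHom_ext_loc G _ _ (fun b => ?_)
    rw [← hη, hg]
    exact hg' b
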